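/- (Unfolding.) Let F ⊆ 2^ω × ω^ω and let A = {x ∈ 2^ω : ∃y ∈ ω^ω, (x,y) ∈ F}, and let s ∈ [0,1). If player I has a winning strategy in the unfolded measure game G_unfolded(s, F), then player I has a winning strategy in the measure game G(s, A); likewise, if player II has a winning strategy in G_unfolded(s, F), then player II has a winning strategy in G(s, A). -/

import Mathlib

open MeasureTheory

namespace MeasureGame

/-- Cantor space `2^ω`. -/
abbrev Cantor : Type := ℕ → Bool

/-- The basic cylinder set `N_t` determined by a finite binary string `t`. -/
def cyl (t : List Bool) : Set Cantor := {x | ∀ i : Fin t.length, x i.1 = t.get i}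

/-- A round of the measure game: player I's pair of rationals, then player II's bit. -/
abbrev GRound : Type := (ℚ × ℚ) × Bool

/-- A strategy for player I in the measure game. -/
abbrev StratI : Type := List GRound → ℚ × ℚ

/-- A strategy for player II in the measure game. -/
abbrev StratII : Type := List GRound → ℚ × ℚ → Bool

/-- A run of the measure game. -/
abbrev Run : Type := ℕ → GRound

/-- The history (list of completed rounds) before round `n`. -/
def hist (r : Run) (n : ℕ) : List GRound := (List.range n).map r

/-- Player II's bit at round `n`. -/
def bits (r : Run) (n : ℕ) : Bool := (r n).2

/-- The finite binary string of player II's first `n` bits. -/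
def path (r : Run) (n : ℕ) : List Bool := (List.range n).map (bits r)

/-- The value player I assigned at round `n` to the one-bit extension of the current path by `b`. -/
def valI (r : Run) (n : ℕ) (b : Bool) : ℚ := if b then (r n).1.2 else (r n).1.1

/-- The value selected by player II's move at round `n`. -/
def sel (r : Run) (n : ℕ) : ℚ := valI r n (bits r n)

/-- Legality requirements on the single value player I assigned to `path r n ++ [b]`:
it is nonnegative, at most `μ(N_{t⌢b})`, and strictly below it when the latter is positive. -/
def mOK (μ : Measure Cantor) (r : Run) (n : ℕ) (b : Bool) : Prop :=
  0 ≤ valI r n b ∧ ((valI r n b : ℝ) ≤ (μ (cyl (path r n ++ [b]))).toReal) ∧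
    (0 < (μ (cyl (path r n ++ [b]))).toReal → (valI r n b : ℝ) < (μ (cyl (path r n ++ [b]))).toReal)

/-- Player I's move at round `n` of a run is legal (for the game `G(s, ·)`). -/
def IOK (μ : Measure Cantor) (s : ℝ) (r : Run) : ℕ → Prop
  | 0 => mOK μ r 0 false ∧ mOK μ r 0 true ∧ s < ((r 0).1.1 : ℝ) + ((r 0).1.2 : ℝ)
  | (n + 1) => mOK μ r (n + 1) false ∧ mOK μ r (n + 1) true ∧
      (r (n + 1)).1.1 + (r (n + 1)).1.2 = sel r n

/-- Player II's move at round `n` of a run is legal: the selected value is nonzero. -/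
def IIOK (r : Run) (n : ℕ) : Prop := sel r n ≠ 0

/-- The run `r` is consistent with player I's strategy `σ`. -/
def ConsI (σ : StratI) (r : Run) : Prop := ∀ n, (r n).1 = σ (hist r n)

/-- The run `r` is consistent with player II's strategy `τ`. -/
def ConsII (τ : StratII) (r : Run) : Prop := ∀ n, (r n).2 = τ (hist r n) (r n).1

/-- Player II wins the run `r` of `G(s, A)`: either player I is the first to break a rule,
or all rules are followed and the sequence of II's bits belongs to `A`. -/
def IIWinsRun (μ : Measure Cantor) (s : ℝ) (A : Set Cantor) (r : Run) : Prop :=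
  (∃ n, (∀ m < n, IOK μ s r m ∧ IIOK r m) ∧ ¬ IOK μ s r n) ∨
    ((∀ n, IOK μ s r n ∧ IIOK r n) ∧ bits r ∈ A)

/-- Player I has a winning strategy in the measure game `G(s, A)`. -/
def WinsI (μ : Measure Cantor) (s : ℝ) (A : Set Cantor) : Prop :=
  ∃ σ : StratI, ∀ r : Run, ConsI σ r → ¬ IIWinsRun μ s A r

/-- Player II has a winning strategy in the measure game `G(s, A)`. -/
def WinsII (μ : Measure Cantor) (s : ℝ) (A : Set Cantor) : Prop :=
  ∃ τ : StratII, ∀ r : Run, ConsII τ r → IIWinsRun μ s A r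

/-- The outer measure `μ*(A) = inf {μ(U) : U open, A ⊆ U}`. -/
noncomputable def outerM (μ : Measure Cantor) (A : Set Cantor) : ℝ :=
  sInf {v : ℝ | ∃ U : Set Cantor, IsOpen U ∧ A ⊆ U ∧ v = (μ U).toReal}

/-- The inner measure `μ_*(A) = sup {μ(F) : F closed, F ⊆ A}`. -/
noncomputable def innerM (μ : Measure Cantor) (A : Set Cantor) : ℝ :=
  sSup {v : ℝ | ∃ F : Set Cantor, IsClosed F ∧ F ⊆ A ∧ v = (μ F).toReal}


/-! The unfolded measure game `G_unfolded(s, F)` for `F ⊆ 2^ω × ω^ω`: player I moves as in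
the measure game; player II plays a bit at each round and, at infinitely many rounds,
additionally a natural number, thereby producing `x ∈ 2^ω` and `y ∈ ω^ω`. -/

/-- Baire space `ω^ω`. -/
abbrev Baire : Type := ℕ → ℕ

/-- A round of the unfolded game: player I's pair of rationals, then player II's bit
together with an optional digit of `y`. -/
abbrev GRoundU : Type := (ℚ × ℚ) × (Bool × Option ℕ)

/-- A strategy for player I in the unfolded game. -/
abbrev StratIU : Type := List GRoundU → ℚ × ℚ

/-- A strategy for player II in the unfolded game. -/
abbrev StratIIU : Type := List GRoundU → ℚ × ℚ → Bool × Option ℕ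

/-- A run of the unfolded game. -/
abbrev RunU : Type := ℕ → GRoundU

def histU (r : RunU) (n : ℕ) : List GRoundU := (List.range n).map r

def bitsU (r : RunU) (n : ℕ) : Bool := (r n).2.1

def pathU (r : RunU) (n : ℕ) : List Bool := (List.range n).map (bitsU r)

def valIU (r : RunU) (n : ℕ) (b : Bool) : ℚ := if b then (r n).1.2 else (r n).1.1

def selU (r : RunU) (n : ℕ) : ℚ := valIU r n (bitsU r n)

def mOKU (μ : Measure Cantor) (r : RunU) (n : ℕ) (b : Bool) : Prop :=
  0 ≤ valIU r n b ∧ ((valIU r n b : ℝ) ≤ (μ (cyl (pathU r n ++ [b]))).toReal) ∧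
    (0 < (μ (cyl (pathU r n ++ [b]))).toReal →
      (valIU r n b : ℝ) < (μ (cyl (pathU r n ++ [b]))).toReal)

def IOKU (μ : Measure Cantor) (s : ℝ) (r : RunU) : ℕ → Prop
  | 0 => mOKU μ r 0 false ∧ mOKU μ r 0 true ∧ s < ((r 0).1.1 : ℝ) + ((r 0).1.2 : ℝ)
  | (n + 1) => mOKU μ r (n + 1) false ∧ mOKU μ r (n + 1) true ∧
      (r (n + 1)).1.1 + (r (n + 1)).1.2 = selU r n

def IIOKU (r : RunU) (n : ℕ) : Prop := selU r n ≠ 0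

def ConsIU (σ : StratIU) (r : RunU) : Prop := ∀ n, (r n).1 = σ (histU r n)

def ConsIIU (τ : StratIIU) (r : RunU) : Prop := ∀ n, (r n).2 = τ (histU r n) (r n).1

/-- In the run `r`, player II plays digits at infinitely many rounds and the digits played,
in order, form exactly the sequence `y`. -/
def ProducesY (r : RunU) (y : Baire) : Prop :=
  ∃ k : ℕ → ℕ, StrictMono k ∧ (∀ n, ((r n).2.2).isSome ↔ ∃ i, k i = n) ∧
    ∀ i, (r (k i)).2.2 = some (y i)

/-- Player II wins the run `r` of `G_unfolded(s, F)`: either player I is the first to break a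
(closed) rule, or all closed rules are followed, II plays infinitely many digits producing
some `y`, and `(x, y) ∈ F`. -/
def IIWinsRunU (μ : Measure Cantor) (s : ℝ) (F : Set (Cantor × Baire)) (r : RunU) : Prop :=
  (∃ n, (∀ m < n, IOKU μ s r m ∧ IIOKU r m) ∧ ¬ IOKU μ s r n) ∨
    ((∀ n, IOKU μ s r n ∧ IIOKU r n) ∧ ∃ y : Baire, ProducesY r y ∧ (bitsU r, y) ∈ F)

/-- Player I has a winning strategy in the unfolded game `G_unfolded(s, F)`. -/
def WinsIU (μ : Measure Cantor) (s : ℝ) (F : Set (Cantor × Baire)) : Prop :=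
  ∃ σ : StratIU, ∀ r : RunU, ConsIU σ r → ¬ IIWinsRunU μ s F r

/-- Player II has a winning strategy in the unfolded game `G_unfolded(s, F)`. -/
def WinsIIU (μ : Measure Cantor) (s : ℝ) (F : Set (Cantor × Baire)) : Prop :=
  ∃ τ : StratIIU, ∀ r : RunU, ConsIIU τ r → IIWinsRunU μ s F r

def pre {α : Type} (z : ℕ → α) (n : ℕ) : List α := (List.range n).map z

theorem pre_length {α : Type} (z : ℕ → α) (n : ℕ) : (pre z n).length = n := by simp [pre]

theorem pre_succ {α : Type} (z : ℕ → α) (n : ℕ) : pre z (n+1) = pre z n ++ [z n] := by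
  simp [pre, List.range_succ]

theorem mem_cyl_nil (x : Cantor) : x ∈ cyl [] := by
  intro i; exact i.elim0

theorem mem_cyl_snoc (x : Cantor) (t : List Bool) (b : Bool) :
    x ∈ cyl (t ++ [b]) ↔ x ∈ cyl t ∧ x t.length = b := by
  constructor
  · intro h
    refine ⟨fun i => ?_, ?_⟩
    · have := h ⟨i.1, by have := i.2; simp⟩
      simpa using this
    · have := h ⟨t.length, by simp⟩
      simpa using this
  · rintro ⟨h1, h2⟩ ⟨i, hi⟩
    simp at hi
    rcases Nat.lt_or_ge i t.length with h | h
    · have := h1 ⟨i, h⟩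
      simpa [List.getElem_append, h] using this
    · have : i = t.length := by omega
      subst this
      simpa using h2

theorem mem_cyl_pre (x : Cantor) (t : List Bool) : x ∈ cyl t ↔ pre x t.length = t := by
  induction t using List.reverseRecOn with
  | nil => simp [pre, mem_cyl_nil]
  | append_singleton t b ih =>
    rw [mem_cyl_snoc, ih]
    simp only [List.length_append, List.length_singleton, pre_succ]
    constructor
    · rintro ⟨h1, h2⟩; rw [h1, h2]
    · intro h
      have := List.append_inj' h rfl
      exact ⟨this.1, by simpa using this.2⟩

theorem mem_cyl_self (x : Cantor) (n : ℕ) : x ∈ cyl (pre x n) := by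
  rw [mem_cyl_pre, pre_length]

theorem isClopen_cyl (t : List Bool) : IsClopen (cyl t) := by
  have : cyl t = ⋂ i : Fin t.length, (fun x : Cantor => x i.1) ⁻¹' {t.get i} := by
    ext x; simp [cyl]
  rw [this]
  apply isClopen_iInter_of_finite
  intro i
  exact (isClopen_discrete _).preimage (continuous_apply _)

theorem meas_cyl (t : List Bool) : MeasurableSet (cyl t) := (isClopen_cyl t).isOpen.measurableSet

theorem cyl_union (t : List Bool) : cyl t = cyl (t ++ [false]) ∪ cyl (t ++ [true]) := by
  ext x
  simp only [Set.mem_union, mem_cyl_snoc]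
  cases x t.length <;> simp

theorem cyl_disj (t : List Bool) : Disjoint (cyl (t ++ [false])) (cyl (t ++ [true])) := by
  rw [Set.disjoint_left]
  intro x h1 h2
  rw [mem_cyl_snoc] at h1 h2
  rw [h1.2] at h2
  simp at h2

/-- points near `x` -/
theorem cyl_nhds (x : Cantor) (U : Set Cantor) (hU : U ∈ nhds x) : ∃ n, cyl (pre x n) ⊆ U := by
  rw [nhds_pi, Filter.mem_pi] at hU
  obtain ⟨I, hI, t, ht, hs⟩ := hU
  obtain ⟨N, hN⟩ := hI.bddAbove
  refine ⟨N+1, fun y hy => hs ?_⟩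
  intro i hi
  have h1 : i < N + 1 := Nat.lt_succ_of_le (hN hi)
  have := hy ⟨i, by rw [pre_length]; exact h1⟩
  simp [pre] at this
  rw [this]
  exact mem_of_mem_nhds (ht i)

theorem cyl_pre_anti (x : Cantor) {m n : ℕ} (h : m ≤ n) : cyl (pre x n) ⊆ cyl (pre x m) := by
  induction n, h using Nat.le_induction with
  | base => exact subset_rfl
  | succ n _ ih =>
    refine subset_trans ?_ ih
    intro y hy
    rw [pre_succ, mem_cyl_snoc] at hy
    exact hy.1

theorem compare_open (ρ₁ ρ₂ : Measure Cantor) (N : ℕ)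
    (h : ∀ u : List Bool, N ≤ u.length → ρ₁ (cyl u) ≤ ρ₂ (cyl u)) (U : Set Cantor) (hU : IsOpen U) :
    ρ₁ U ≤ ρ₂ U := by
  let D : ℕ → Set (List Bool) := fun n => {u | u.length = N + n ∧ cyl u ⊆ U}
  let V : ℕ → Set Cantor := fun n => ⋃ u ∈ D n, cyl u
  have hdisj : ∀ n, (D n).PairwiseDisjoint cyl := by
    intro n u hu v hv huv
    refine Set.disjoint_left.2 fun x hx hx' => huv ?_
    rw [mem_cyl_pre] at hx hx'
    rw [← hx, ← hx', hu.1, hv.1]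
  have hmem : ∀ n x, x ∈ V n ↔ cyl (pre x (N+n)) ⊆ U := by
    intro n x
    simp only [V, Set.mem_iUnion, D, Set.mem_ofPred_eq]
    constructor
    · rintro ⟨u, ⟨h1, h2⟩, h3⟩
      rw [mem_cyl_pre] at h3
      rw [← h1, h3]; exact h2
    · intro h
      exact ⟨_, ⟨pre_length _ _, h⟩, mem_cyl_self _ _⟩
  have hmono : Monotone V := by
    intro a b hab x hx
    rw [hmem] at hx ⊢
    exact (cyl_pre_anti x (by omega)).trans hx
  have hUV : U = ⋃ n, V n := by
    ext x
    simp only [Set.mem_iUnion, hmem]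
    constructor
    · intro hx
      obtain ⟨n, hn⟩ := cyl_nhds x U (hU.mem_nhds hx)
      exact ⟨n, (cyl_pre_anti x (by omega)).trans hn⟩
    · rintro ⟨n, hn⟩
      exact hn (mem_cyl_self _ _)
  have hV : ∀ n, ρ₁ (V n) ≤ ρ₂ (V n) := by
    intro n
    rw [measure_biUnion (Set.to_countable _) (hdisj n) (fun u _ => meas_cyl u),
      measure_biUnion (Set.to_countable _) (hdisj n) (fun u _ => meas_cyl u)]
    exact ENNReal.tsum_le_tsum fun u => h u.1 (by have := u.2.1; omega)
  rw [hUV, hmono.measure_iUnion, hmono.measure_iUnion]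
  exact iSup_mono hV

theorem compare (ρ₁ ρ₂ : Measure Cantor) [IsFiniteMeasure ρ₂] (N : ℕ)
    (h : ∀ u : List Bool, N ≤ u.length → ρ₁ (cyl u) ≤ ρ₂ (cyl u)) (B : Set Cantor) :
    ρ₁ B ≤ ρ₂ B := by
  rw [Set.measure_eq_iInf_isOpen B ρ₂]
  refine le_iInf fun U => le_iInf fun hBU => le_iInf fun hU => ?_
  exact (measure_mono hBU).trans (compare_open ρ₁ ρ₂ N h U hU)

abbrev Mv : Type := Bool × Option ℕ

abbrev bt (q : List Mv) : List Bool := q.map Prod.fst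

section core

variable (μ : Measure Cantor) (W : List Mv → ℝ)

def good (k : ℕ) (q : List Mv) : Prop := 0 < W q ∧ μ.real (cyl (bt q)) ≤ (k + 1) * W q

open Classical in
noncomputable def Tn (k : ℕ) : ℕ → List Mv → Set Cantor
  | 0, q => cyl (bt q)
  | n+1, q => if good μ W k q then Tn k n (q ++ [(false, none)]) ∪ Tn k n (q ++ [(true, none)]) else ∅

noncomputable def Tk (k : ℕ) (q : List Mv) : Set Cantor := ⋂ n, Tn μ W k n q

noncomputable def TT (q : List Mv) : Set Cantor := ⋃ k, Tk μ W k q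

theorem meas_Tn (k n : ℕ) (q : List Mv) : MeasurableSet (Tn μ W k n q) := by
  induction n generalizing q with
  | zero => exact meas_cyl _
  | succ n ih =>
    rw [Tn]
    split_ifs
    · exact (ih _).union (ih _)
    · exact MeasurableSet.empty

theorem meas_Tk (k : ℕ) (q : List Mv) : MeasurableSet (Tk μ W k q) :=
  MeasurableSet.iInter fun n => meas_Tn μ W k n q

theorem meas_TT (q : List Mv) : MeasurableSet (TT μ W q) :=
  MeasurableSet.iUnion fun k => meas_Tk μ W k q

theorem Tn_sub (k n : ℕ) (q : List Mv) : Tn μ W k n q ⊆ cyl (bt q) := by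
  induction n generalizing q with
  | zero => exact subset_rfl
  | succ n ih =>
    rw [Tn]
    split_ifs
    · rw [cyl_union (bt q)]
      have h1 := ih (q ++ [(false, none)])
      have h2 := ih (q ++ [(true, none)])
      simp only [bt, List.map_append, List.map_cons, List.map_nil] at h1 h2
      exact Set.union_subset_union h1 h2
    · exact Set.empty_subset _

theorem Tn_anti (k n : ℕ) (q : List Mv) : Tn μ W k (n+1) q ⊆ Tn μ W k n q := by
  induction n generalizing q with
  | zero => exact Tn_sub μ W k 1 q
  | succ n ih =>
    rw [Tn.eq_2 (μ := μ) (W := W) (k := k) q (n + 1), Tn.eq_2 (μ := μ) (W := W) (k := k) q n]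
    split_ifs with h
    · exact Set.union_subset_union (ih _) (ih _)
    · exact Set.empty_subset _

theorem Tk_sub (k : ℕ) (q : List Mv) : Tk μ W k q ⊆ cyl (bt q) :=
  (Set.iInter_subset _ 0)

theorem TT_sub (q : List Mv) : TT μ W q ⊆ cyl (bt q) :=
  Set.iUnion_subset fun k => Tk_sub μ W k q

/-- extension by no-digit moves -/
def ext (q : List Mv) (l : List Bool) : List Mv := q ++ l.map (fun b => (b, none))

theorem bt_ext (q : List Mv) (l : List Bool) : bt (ext q l) = bt q ++ l := by
  simp [ext, Function.comp_def]

theorem Tn_good (k : ℕ) (l : List Bool) (n : ℕ) (hn : l.length < n) (q : List Mv) (x : Cantor)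
    (hx : x ∈ Tn μ W k n q) (hl : x ∈ cyl (bt q ++ l)) : good μ W k (ext q l) := by
  induction l generalizing n q with
  | nil =>
    obtain ⟨n, rfl⟩ : ∃ m, n = m + 1 := ⟨n - 1, by simp at hn; omega⟩
    rw [Tn] at hx
    split_ifs at hx with h
    · simpa [ext] using h
    · exact hx.elim
  | cons b l ih =>
    obtain ⟨n, rfl⟩ : ∃ m, n = m + 1 := ⟨n - 1, by simp at hn; omega⟩
    rw [Tn] at hx
    have hxb : x q.length = b := by
      have := hl ⟨q.length, by simp⟩
      simpa using this
    split_ifs at hx with h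
    · have key : ∀ c, x ∈ Tn μ W k n (q ++ [(c, none)]) → c = b := by
        intro c hc
        have := Tn_sub μ W k n _ hc
        simp only [bt, List.map_append, List.map_cons, List.map_nil, mem_cyl_snoc] at this
        rw [← hxb, ← this.2]; simp
      have hx' : x ∈ Tn μ W k n (q ++ [(b, none)]) := by
        rcases hx with hx | hx
        · rwa [← key _ hx]
        · rwa [← key _ hx]
      have := ih n (by simp at hn; omega) (q ++ [(b, none)]) hx' (by simpa using hl)
      simpa [ext] using this
    · exact hx.elim

theorem Tk_good (k : ℕ) (l : List Bool) (q : List Mv) (x : Cantor)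
    (hx : x ∈ Tk μ W k q) (hl : x ∈ cyl (bt q ++ l)) : good μ W k (ext q l) :=
  Tn_good μ W k l (l.length + 1) (by omega) q x (Set.mem_iInter.1 hx _) hl

variable [IsProbabilityMeasure μ]

theorem real_split (t : List Bool) :
    μ.real (cyl t) = μ.real (cyl (t ++ [false])) + μ.real (cyl (t ++ [true])) := by
  conv_lhs => rw [cyl_union t]
  exact measureReal_union (cyl_disj t) (meas_cyl _)

theorem Tn_bound
  (hb : ∀ q o o', W (q ++ [(false, o)]) + W (q ++ [(true, o')]) = W q)
  (ha0 : ∀ q, 0 ≤ W q) (ha : ∀ q, W q ≤ μ.real (cyl (bt q)))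
  (k n : ℕ) (q : List Mv) :
    W q ≤ μ.real (Tn μ W k n q) + (1 / ((k:ℝ) + 1)) * μ.real (cyl (bt q)) := by
  have hk : (0:ℝ) < k + 1 := by positivity
  induction n generalizing q with
  | zero =>
    rw [Tn]
    have := ha q
    have : 0 ≤ (1 / ((k:ℝ) + 1)) * μ.real (cyl (bt q)) := by positivity
    linarith [ha q]
  | succ n ih =>
    rw [Tn]
    split_ifs with h
    · have h1 := ih (q ++ [(false, none)])
      have h2 := ih (q ++ [(true, none)])
      have h3 := hb q none none
      have h4 := real_split μ (bt q)
      have hd : Disjoint (Tn μ W k n (q ++ [(false, none)])) (Tn μ W k n (q ++ [(true, none)])) := by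
        have := cyl_disj (bt q)
        refine Set.disjoint_of_subset (Tn_sub μ W k n _) (Tn_sub μ W k n _) ?_
        simpa using this
      rw [measureReal_union hd (meas_Tn _ _ _ _ _), h4]
      simp only [bt, List.map_append, List.map_cons, List.map_nil] at h1 h2 ⊢
      rw [mul_add]
      linarith
    · have h0 : 0 ≤ μ.real (cyl (bt q)) := measureReal_nonneg
      have : W q ≤ (1 / ((k:ℝ) + 1)) * μ.real (cyl (bt q)) := by
        unfold good at h
        rw [one_div, inv_mul_eq_div, le_div_iff₀ hk]
        by_cases h' : 0 < W q
        · have := not_le.1 (fun h'' => h ⟨h', h''⟩)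
          linarith
        · have : W q = 0 := le_antisymm (not_lt.1 h') (ha0 q)
          rw [this]; simp
      simpa using this

theorem TT_bound
  (hb : ∀ q o o', W (q ++ [(false, o)]) + W (q ++ [(true, o')]) = W q)
  (ha0 : ∀ q, 0 ≤ W q) (ha : ∀ q, W q ≤ μ.real (cyl (bt q)))
  (q : List Mv) : W q ≤ μ.real (TT μ W q) := by
  have h1 : ∀ k : ℕ, W q ≤ μ.real (TT μ W q) + 1 / ((k:ℝ) + 1) := by
    intro k
    have hT : Filter.Tendsto (fun n => μ (Tn μ W k n q)) Filter.atTop (nhds (μ (Tk μ W k q))) :=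
      tendsto_measure_iInter_atTop (fun n => (meas_Tn μ W k n q).nullMeasurableSet)
        (antitone_nat_of_succ_le fun n => Tn_anti μ W k n q) ⟨0, measure_ne_top _ _⟩
    have hT' := (ENNReal.tendsto_toReal (measure_ne_top μ (Tk μ W k q))).comp hT
    have h2 : W q - 1 / ((k:ℝ) + 1) ≤ μ.real (Tk μ W k q) := by
      refine ge_of_tendsto' hT' fun n => ?_
      have h3 := Tn_bound μ W hb ha0 ha k n q
      have h4 : μ.real (cyl (bt q)) ≤ 1 := measureReal_le_one
      have h5 : (1 / ((k:ℝ) + 1)) * μ.real (cyl (bt q)) ≤ 1 / ((k:ℝ) + 1) :=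
        mul_le_of_le_one_right (by positivity) h4
      change _ ≤ μ.real (Tn μ W k n q)
      linarith
    have h3 : μ.real (Tk μ W k q) ≤ μ.real (TT μ W q) :=
      measureReal_mono (Set.subset_iUnion (fun k => Tk μ W k q) k)
    linarith
  have h2 : Filter.Tendsto (fun k : ℕ => μ.real (TT μ W q) + 1 / ((k:ℝ) + 1)) Filter.atTop
      (nhds (μ.real (TT μ W q) + 0)) :=
    tendsto_const_nhds.add tendsto_one_div_add_atTop_nhds_zero_nat
  rw [add_zero] at h2
  exact ge_of_tendsto' h2 h1


noncomputable def CC (q : List Mv) (j : ℕ) : Set Cantor :=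
  ⋃ l : List Bool, ⋃ b : Bool, TT μ W (ext q l ++ [(b, some j)])

theorem null_B
  (hb : ∀ q o o', W (q ++ [(false, o)]) + W (q ++ [(true, o')]) = W q)
  (ha0 : ∀ q, 0 ≤ W q) (ha : ∀ q, W q ≤ μ.real (cyl (bt q)))
  (q : List Mv) (j : ℕ) : μ (TT μ W q \ CC μ W q j) = 0 := by
  have hC : MeasurableSet (CC μ W q j) :=
    MeasurableSet.iUnion fun l => MeasurableSet.iUnion fun b => meas_TT μ W _
  have hoi : ∀ p b (o o' : Option ℕ), W (p ++ [(b, o)]) = W (p ++ [(b, o')]) := by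
    intro p b o o'
    cases b
    · linarith [hb p o o, hb p o' o]
    · linarith [hb p o o, hb p o o']
  rw [TT, Set.iUnion_sdiff]
  rw [measure_iUnion_null_iff]
  intro k
  set B := Tk μ W k q \ CC μ W q j with hB
  have hBm : MeasurableSet B := (meas_Tk μ W k q).diff hC
  have hle : ∀ u : List Bool, q.length + 1 ≤ u.length →
      μ (cyl u) ≤ (((k + 1 : ℕ) : NNReal) • μ.restrict Bᶜ) (cyl u) := by
    intro u hu
    rw [Measure.smul_apply, Measure.restrict_apply (meas_cyl u)]
    by_cases hne : ∃ x, x ∈ cyl u ∧ x ∈ B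
    · obtain ⟨x, hxu, hxB⟩ := hne
      have hxq := Tk_sub μ W k q hxB.1
      obtain ⟨l, b, rfl⟩ : ∃ l b, u = bt q ++ l ++ [b] := by
        rw [mem_cyl_pre] at hxq hxu
        obtain ⟨d, hd⟩ : ∃ d, u.length = q.length + (d + 1) := ⟨u.length - q.length - 1, by omega⟩
        refine ⟨(List.range d).map (fun i => x (q.length + i)), x (q.length + d), ?_⟩
        rw [← hxu, ← hxq, hd]
        simp [pre, List.range_add, List.range_succ, Function.comp_def]
      have hg := Tk_good μ W k (l ++ [b]) q x hxB.1 (by simpa using hxu)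
      have h1 : W (ext q (l ++ [b])) = W (ext q l ++ [(b, some j)]) := by
        have : ext q (l ++ [b]) = ext q l ++ [(b, none)] := by simp [ext]
        rw [this]; exact hoi _ _ _ _
      have h2 := TT_bound μ W hb ha0 ha (ext q l ++ [(b, some j)])
      have h3 : TT μ W (ext q l ++ [(b, some j)]) ⊆ cyl (bt q ++ l ++ [b]) ∩ Bᶜ := by
        intro y hy
        refine ⟨?_, fun hyB => hyB.2 ?_⟩
        · have := TT_sub μ W _ hy
          simp only [bt, List.map_append, List.map_cons, List.map_nil] at this
          have e := bt_ext q l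
          simp only [bt] at e
          rwa [e] at this
        · exact Set.mem_iUnion.2 ⟨l, Set.mem_iUnion.2 ⟨b, hy⟩⟩
      have h4 : μ.real (TT μ W (ext q l ++ [(b, some j)])) ≤ μ.real (cyl (bt q ++ l ++ [b]) ∩ Bᶜ) :=
        measureReal_mono h3
      have h5 : μ.real (cyl (bt q ++ l ++ [b])) ≤ (k+1) * μ.real (cyl (bt q ++ l ++ [b]) ∩ Bᶜ) := by
        have := hg.2
        rw [bt_ext, ← List.append_assoc] at this
        refine this.trans ?_
        rw [h1]
        exact mul_le_mul_of_nonneg_left (h2.trans h4) (by positivity)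
      rw [← ENNReal.toReal_le_toReal (measure_ne_top _ _)
        (by rw [ENNReal.smul_def]; exact ENNReal.mul_ne_top (by simp) (measure_ne_top _ _))]
      rw [ENNReal.smul_def, smul_eq_mul, ENNReal.toReal_mul]
      rw [ENNReal.coe_toReal, NNReal.coe_natCast]
      push_cast
      exact h5
    · have : cyl u ∩ Bᶜ = cyl u := by
        ext x; constructor
        · exact fun h => h.1
        · exact fun h => ⟨h, fun h' => hne ⟨x, h, h'⟩⟩
      rw [this, ENNReal.smul_def, smul_eq_mul]
      refine le_mul_of_one_le_left (by simp) ?_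
      simp
  have := compare μ _ _ hle B
  rw [Measure.smul_apply, Measure.restrict_apply hBm] at this
  simpa using this

theorem W_pos_of_TT (q : List Mv) (x : Cantor) (hx : x ∈ TT μ W q) : 0 < W q := by
  obtain ⟨k, hk⟩ := Set.mem_iUnion.1 hx
  have := Tk_good μ W k [] q x hk (by simpa using Tk_sub μ W k q hk)
  simpa [ext] using this.1

theorem core_thm
  (hb : ∀ q o o', W (q ++ [(false, o)]) + W (q ++ [(true, o')]) = W q)
  (ha0 : ∀ q, 0 ≤ W q) (ha : ∀ q, W q ≤ μ.real (cyl (bt q)))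
  (F : Set (Cantor × Baire)) (s : ℝ) (hs0 : 0 ≤ s) (hsW : s < W [])
  (hd : ∀ z : ℕ → Mv, (∀ n, W (pre z n) ≠ 0) → ∀ y : Baire, ∀ k : ℕ → ℕ, StrictMono k →
    (∀ n, ((z n).2).isSome ↔ ∃ i, k i = n) → (∀ i, (z (k i)).2 = some (y i)) →
    (fun n => (z n).1, y) ∉ F) :
  ∃ K : Set Cantor, IsClosed K ∧ s < μ.real K ∧ ∀ x ∈ K, ∀ y, (x, y) ∉ F := by
  have hWpre : ∀ p r, W (p ++ r) ≤ W p := by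
    intro p r
    induction r using List.reverseRecOn with
    | nil => simp
    | append_singleton r m ih =>
      rw [← List.append_assoc]
      refine le_trans ?_ ih
      obtain ⟨b, o⟩ := m
      cases b
      · linarith [hb (p ++ r) o o, ha0 (p ++ r ++ [(true, o)])]
      · linarith [hb (p ++ r) o o, ha0 (p ++ r ++ [(false, o)])]
  set N : Set Cantor := ⋃ q : List Mv, ⋃ j : ℕ, (TT μ W q \ CC μ W q j) with hN
  have hN0 : μ N = 0 := by
    rw [hN, measure_iUnion_null_iff]
    intro q
    rw [measure_iUnion_null_iff]
    intro j
    exact null_B μ W hb ha0 ha q j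
  have hmain : ∀ x ∈ TT μ W [], x ∉ N → ∀ y, (x, y) ∉ F := by
    intro x hx hxN y hF
    have hstep : ∀ q : {q : List Mv // x ∈ TT μ W q}, ∀ j : ℕ,
        ∃ q' : {q : List Mv // x ∈ TT μ W q}, ∃ l b, q'.1 = ext q.1 l ++ [(b, some j)] := by
      rintro ⟨q, hq⟩ j
      have : x ∈ CC μ W q j := by
        by_contra h
        exact hxN (Set.mem_iUnion.2 ⟨q, Set.mem_iUnion.2 ⟨j, hq, h⟩⟩)
      obtain ⟨l, hl⟩ := Set.mem_iUnion.1 this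
      obtain ⟨b, hb'⟩ := Set.mem_iUnion.1 hl
      exact ⟨⟨_, hb'⟩, l, b, rfl⟩
    choose nx lx bx hnx using hstep
    let Q' : ℕ → {q : List Mv // x ∈ TT μ W q} := fun n => Nat.rec ⟨[], hx⟩ (fun i q => nx q (y i)) n
    let Q : ℕ → List Mv := fun n => (Q' n).1
    have hQT : ∀ n, x ∈ TT μ W (Q n) := fun n => (Q' n).2
    have hQ0 : Q 0 = [] := rfl
    have hQs : ∀ n, ∃ (l : List Bool) (b : Bool), Q (n+1) = Q n ++ (l.map (fun b => (b, none)) ++ [(b, some (y n))]) := by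
      intro n
      refine ⟨lx (Q' n) (y n), bx (Q' n) (y n), ?_⟩
      have := hnx (Q' n) (y n)
      rw [ext, List.append_assoc] at this
      exact this
    choose L b hQs using hQs
    have hlen : ∀ n, (Q (n+1)).length = (Q n).length + (L n).length + 1 := by
      intro n; rw [hQs]; simp; omega
    have hmono : StrictMono fun n => (Q n).length := by
      apply strictMono_nat_of_lt_succ
      intro n; rw [hlen]; omega
    have hlen' : ∀ n, n ≤ (Q n).length := fun n => hmono.le_apply
    have hpref : ∀ m n, m ≤ n → Q m <+: Q n := by
      intro m n hmn
      induction n, hmn using Nat.le_induction with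
      | base => exact List.prefix_rfl
      | succ n _ ih => exact ih.trans (by rw [hQs]; exact List.prefix_append _ _)
    let z : ℕ → Mv := fun n => (Q (n+1)).getD n (false, none)
    have hz : ∀ m n, n < (Q m).length → (Q m)[n]? = some (z n) := by
      intro m n hn
      have h1 : n < (Q (n+1)).length := hlen' (n+1)
      have h2 : (Q (n+1))[n]? = some (z n) := by
        simp [z, h1]
      rw [← h2]
      rcases le_total m (n+1) with h | h
      · obtain ⟨t, ht⟩ := hpref _ _ h
        rw [← ht, List.getElem?_append_left hn]
      · obtain ⟨t, ht⟩ := hpref _ _ h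
        rw [← ht, List.getElem?_append_left h1]
    have hzpre : ∀ n, pre z (Q n).length = Q n := by
      intro n
      apply List.ext_getElem?
      intro i
      by_cases hi : i < (Q n).length
      · rw [hz n i hi]; simp [pre, hi]
      · rw [List.getElem?_eq_none (by rw [pre_length]; omega), List.getElem?_eq_none (by omega)]
    have hpz : ∀ m n, m ≤ n → ∃ r, pre z n = pre z m ++ r := by
      intro m n hmn
      induction n, hmn using Nat.le_induction with
      | base => exact ⟨[], by simp⟩
      | succ n _ ih =>
        obtain ⟨r, hr⟩ := ih
        exact ⟨r ++ [z n], by rw [pre_succ, hr, List.append_assoc]⟩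
    have hzx : (fun n => (z n).1) = x := by
      funext n
      have h1 := TT_sub μ W _ (hQT (n+1))
      have hlt : n < (Q (n+1)).length := hlen' (n+1)
      have h2 := h1 ⟨n, by simpa using hlt⟩
      have h3 := hz (n+1) n hlt
      rw [List.getElem?_eq_getElem hlt] at h3
      simp at h2 h3
      rw [h2, h3]
    have hlast : ∀ i, z ((Q i).length + (L i).length) = (b i, some (y i)) := by
      intro i
      have := hz (i+1) ((Q i).length + (L i).length) (by rw [hlen]; omega)
      rw [hQs] at this
      rw [List.getElem?_append_right (by omega), List.getElem?_append_right (by simp)] at this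
      simpa using this.symm
    have hmid : ∀ i d, d < (L i).length → (z ((Q i).length + d)).2 = none := by
      intro i d hd
      have := hz (i+1) ((Q i).length + d) (by rw [hlen]; omega)
      rw [hQs] at this
      rw [List.getElem?_append_right (by omega), List.getElem?_append_left (by simpa using hd)] at this
      simp [hd] at this
      rw [← this]
    refine hd z ?_ y (fun i => (Q i).length + (L i).length) ?_ ?_ ?_ (by rw [hzx]; exact hF)
    · intro n
      obtain ⟨r, hr⟩ := hpz n _ (hlen' n)
      have h1 := W_pos_of_TT μ W _ x (hQT n)
      rw [← hzpre n, hr] at h1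
      exact (h1.trans_le (hWpre _ _)).ne'
    · apply strictMono_nat_of_lt_succ
      intro n
      have := hlen n
      omega
    · intro n
      constructor
      · intro hn
        have hex : ∃ m, n < (Q m).length := ⟨n+1, hlen' (n+1)⟩
        classical
        have h1 := Nat.find_spec hex
        have h2 := fun m => Nat.find_min hex (m := m)
        cases hf : Nat.find hex with
        | zero => rw [hf, hQ0] at h1; simp at h1
        | succ i =>
          rw [hf] at h1 h2
          have h3 := h2 i (by omega)
          rw [hlen] at h1
          refine ⟨i, ?_⟩
          by_contra hne
          have := hmid i (n - (Q i).length) (by omega)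
          rw [show (Q i).length + (n - (Q i).length) = n by omega] at this
          rw [this] at hn
          simp at hn
      · rintro ⟨i, rfl⟩
        rw [hlast]; simp
    · intro i
      rw [hlast]
  have hT := TT_bound μ W hb ha0 ha []
  have hm : MeasurableSet (TT μ W [] \ toMeasurable μ N) :=
    (meas_TT μ W []).diff (measurableSet_toMeasurable _ _)
  have hμ : μ (TT μ W [] \ toMeasurable μ N) = μ (TT μ W []) :=
    measure_sdiff_null (by rw [measure_toMeasurable, hN0])
  have hlt : ENNReal.ofReal s < μ (TT μ W [] \ toMeasurable μ N) := by
    rw [hμ, ENNReal.ofReal_lt_iff_lt_toReal hs0 (measure_ne_top _ _)]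
    exact hsW.trans_le hT
  obtain ⟨K, hK, hKc, hKμ⟩ := hm.exists_lt_isClosed_of_ne_top (measure_ne_top _ _) hlt
  refine ⟨K, hKc, ?_, ?_⟩
  · rwa [ENNReal.ofReal_lt_iff_lt_toReal hs0 (measure_ne_top _ _)] at hKμ
  · intro x hx y
    exact hmain x (hK hx).1 (fun h => (hK hx).2 (subset_toMeasurable _ _ h)) y

end core

/-! ### The unfolded game -/

section gameU

variable (σ : StratIU)

def Vb (p : ℚ × ℚ) (b : Bool) : ℚ := if b then p.2 else p.1

def stepU (h : List GRoundU × ℚ) (m : Mv) : List GRoundU × ℚ :=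
  (h.1 ++ [(σ h.1, m)], if h.2 = 0 then 0 else Vb (σ h.1) m.1)

def SU (q : List Mv) : List GRoundU × ℚ := q.foldl (stepU σ) ([], (σ []).1 + (σ []).2)

theorem SU_snoc (q : List Mv) (m : Mv) : SU σ (q ++ [m]) = stepU σ (SU σ q) m := by
  simp [SU, List.foldl_append]

def WU (q : List Mv) : ℚ := (SU σ q).2

def runU (z : ℕ → Mv) : RunU := fun n => (σ (SU σ (pre z n)).1, z n)

theorem hist_runU (z : ℕ → Mv) (n : ℕ) : histU (runU σ z) n = (SU σ (pre z n)).1 := by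
  induction n with
  | zero => simp [histU, pre, SU]
  | succ n ih =>
    rw [pre_succ, SU_snoc]
    simp only [histU, stepU, List.range_succ, List.map_append, List.map_cons, List.map_nil] at ih ⊢
    rw [ih]; rfl

theorem cons_runU (z : ℕ → Mv) : ConsIU σ (runU σ z) := by
  intro n
  rw [hist_runU]; rfl

theorem path_runU (z : ℕ → Mv) (n : ℕ) : pathU (runU σ z) n = bt (pre z n) := by
  simp [pathU, pre, bt, bitsU, runU, Function.comp_def]

theorem val_runU (z : ℕ → Mv) (n : ℕ) (b : Bool) :
    valIU (runU σ z) n b = Vb (σ (SU σ (pre z n)).1) b := rfl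

theorem WU_succ (z : ℕ → Mv) (n : ℕ) :
    WU σ (pre z (n+1)) = if WU σ (pre z n) = 0 then 0 else selU (runU σ z) n := by
  rw [pre_succ, WU, SU_snoc]; rfl

theorem WU_ne (z : ℕ → Mv) (n : ℕ) (h : WU σ (pre z (n+1)) ≠ 0) :
    WU σ (pre z n) ≠ 0 ∧ selU (runU σ z) n = WU σ (pre z (n+1)) := by
  rw [WU_succ] at h ⊢
  split_ifs at h ⊢ with h'
  · exact absurd rfl h
  · exact ⟨h', rfl⟩

theorem WU_ne_le (z : ℕ → Mv) (n m : ℕ) (hmn : m ≤ n) (h : WU σ (pre z n) ≠ 0) :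
    WU σ (pre z m) ≠ 0 := by
  induction n, hmn using Nat.le_induction with
  | base => exact h
  | succ n _ ih => exact ih (WU_ne σ z n h).1

theorem unfold_I (μ : Measure Cantor) [IsProbabilityMeasure μ]
    (F : Set (Cantor × Baire)) (s : ℝ) (hs0 : 0 ≤ s)
    (hσ : ∀ r : RunU, ConsIU σ r → ¬ IIWinsRunU μ s F r) :
    ∃ K : Set Cantor, IsClosed K ∧ s < μ.real K ∧ ∀ x ∈ K, ∀ y, (x, y) ∉ F := by
  have hI0 : ∀ z, IOKU μ s (runU σ z) 0 := by
    intro z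
    by_contra h
    exact hσ _ (cons_runU σ z) (Or.inl ⟨0, by simp, h⟩)
  have hI : ∀ z n, WU σ (pre z n) ≠ 0 → IOKU μ s (runU σ z) n := by
    intro z n
    induction n using Nat.strong_induction_on with
    | _ n ih =>
      intro hn
      by_contra h
      refine hσ _ (cons_runU σ z) (Or.inl ⟨n, fun m hm => ⟨ih m hm ?_, ?_⟩, h⟩)
      · exact WU_ne_le σ z n m hm.le hn
      · have := WU_ne_le σ z n (m+1) hm hn
        rw [IIOKU, (WU_ne σ z m this).2]
        exact this
  have hW0 : s < ((WU σ [] : ℚ) : ℝ) := by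
    have := (hI0 (fun _ => (false, none))).2.2
    simp only [WU, SU, List.foldl_nil]
    push_cast
    exact this
  have hsn : ∀ q b o, WU σ (q ++ [(b, o)]) = if WU σ q = 0 then 0 else Vb (σ (SU σ q).1) b := by
    intro q b o
    rw [WU, SU_snoc]; rfl
  have hfacts : ∀ q, WU σ q ≠ 0 →
      (Vb (σ (SU σ q).1) false + Vb (σ (SU σ q).1) true = WU σ q) ∧
      ∀ b, 0 ≤ Vb (σ (SU σ q).1) b ∧ (Vb (σ (SU σ q).1) b : ℝ) ≤ μ.real (cyl (bt q ++ [b])) := by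
    intro q hq
    obtain ⟨z, n, rfl⟩ : ∃ z n, q = pre z n := by
      refine ⟨fun i => q.getD i (false, none), q.length, ?_⟩
      apply List.ext_getElem
      · simp [pre]
      · intro i h1 h2
        simp [pre, h1]
    have h := hI z n hq
    have h' : mOKU μ (runU σ z) n false ∧ mOKU μ (runU σ z) n true := by
      cases n with
      | zero => exact ⟨h.1, h.2.1⟩
      | succ n => exact ⟨h.1, h.2.1⟩
    refine ⟨?_, ?_⟩
    · cases n with
      | zero => rfl
      | succ n =>
        have := h.2.2
        rw [(WU_ne σ z n hq).2] at this
        exact this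
    · intro b
      have hb : mOKU μ (runU σ z) n b := by cases b; exacts [h'.1, h'.2]
      rw [mOKU, path_runU, val_runU] at hb
      exact ⟨hb.1, hb.2.1⟩
  have hadd : ∀ q o o', WU σ (q ++ [(false, o)]) + WU σ (q ++ [(true, o')]) = WU σ q := by
    intro q o o'
    rw [hsn, hsn]
    split_ifs with h
    · rw [h]; simp
    · exact (hfacts q h).1
  have hb0 : ∀ q b o, 0 ≤ WU σ (q ++ [(b, o)]) ∧
      (WU σ (q ++ [(b, o)]) : ℝ) ≤ μ.real (cyl (bt q ++ [b])) := by
    intro q b o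
    rw [hsn]
    split_ifs with h
    · simp
    · exact (hfacts q h).2 b
  refine core_thm μ (fun q => ((WU σ q : ℚ) : ℝ)) ?_ ?_ ?_ F s hs0 hW0 ?_
  · intro q o o'
    have := hadd q o o'
    rw [← this]; push_cast; ring
  · intro q
    rcases List.eq_nil_or_concat q with rfl | ⟨p, ⟨b, o⟩, rfl⟩
    · exact hs0.trans hW0.le
    · have := (hb0 p b o).1
      rw [List.concat_eq_append]
      exact_mod_cast this
  · intro q
    rcases List.eq_nil_or_concat q with rfl | ⟨p, ⟨b, o⟩, rfl⟩
    · have h1 := (hb0 [] false none).2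
      have h2 := (hb0 [] true none).2
      have h3 := hadd [] none none
      have h4 := real_split μ []
      simp only [bt, List.map_nil, List.nil_append] at *
      rw [h4, ← h3]; push_cast; linarith
    · have := (hb0 p b o).2
      rw [List.concat_eq_append]
      simpa using this
  · intro z hz y k hk1 hk2 hk3 hF
    have hz' : ∀ n, WU σ (pre z n) ≠ 0 := fun n h => hz n (by simp [h])
    refine hσ _ (cons_runU σ z) (Or.inr ⟨fun n => ⟨hI z n (hz' n), ?_⟩, y, ⟨k, hk1, hk2, hk3⟩, hF⟩)
    rw [IIOKU, (WU_ne σ z n (hz' (n+1))).2]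
    exact hz' (n+1)

end gameU

/-! ### Player I wins the measure game from a closed set -/

theorem split_exists (κ κ0 κ1 : ℝ) (h : κ = κ0 + κ1) (h0 : 0 ≤ κ0) (h1 : 0 ≤ κ1) (m : ℚ)
    (hm : 0 ≤ m) (hm' : m = 0 ∨ (m : ℝ) < κ) :
    ∃ p : ℚ × ℚ, p.1 + p.2 = m ∧ (0 ≤ p.1 ∧ (p.1 = 0 ∨ (p.1 : ℝ) < κ0)) ∧
      (0 ≤ p.2 ∧ (p.2 = 0 ∨ (p.2 : ℝ) < κ1)) := by
  by_cases hz : m = 0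
  · exact ⟨(0, 0), by simp [hz], by simp, by simp⟩
  have hmκ : (m : ℝ) < κ := hm'.resolve_left hz
  have hmpos : (0 : ℝ) < m := by exact_mod_cast lt_of_le_of_ne hm (Ne.symm hz)
  by_cases hκ0 : κ0 = 0
  · exact ⟨(0, m), by simp, by simp, hm, Or.inr (by simp only; linarith)⟩
  by_cases hκ1 : κ1 = 0
  · exact ⟨(m, 0), by simp, ⟨hm, Or.inr (by simp only; linarith)⟩, by simp⟩
  have hκ0' : 0 < κ0 := lt_of_le_of_ne h0 (Ne.symm hκ0)
  have hκ1' : 0 < κ1 := lt_of_le_of_ne h1 (Ne.symm hκ1)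
  obtain ⟨a, ha1, ha2⟩ := exists_rat_btwn
    (show max 0 ((m:ℝ) - κ1) < min (m:ℝ) κ0 from
      max_lt (lt_min hmpos hκ0') (lt_min (by linarith) (by linarith)))
  rw [max_lt_iff] at ha1
  rw [lt_min_iff] at ha2
  refine ⟨(a, m - a), by simp, ⟨?_, Or.inr ha2.2⟩, ?_, Or.inr ?_⟩
  · exact_mod_cast ha1.1.le
  · have : (a:ℚ) < m := by exact_mod_cast ha2.1
    simp only; linarith
  · push_cast; linarith [ha1.2]

theorem wins_of_closed (μ : Measure Cantor) [IsProbabilityMeasure μ] (A : Set Cantor) (s : ℝ)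
    (hs0 : 0 ≤ s) (K : Set Cantor) (hK : IsClosed K) (hμK : s < μ.real K) (hKA : ∀ x ∈ K, x ∉ A) :
    WinsI μ s A := by
  classical
  let κ : List Bool → ℝ := fun t => μ.real (cyl t ∩ K)
  have hκs : ∀ t, κ t = κ (t ++ [false]) + κ (t ++ [true]) := by
    intro t
    simp only [κ]
    conv_lhs => rw [cyl_union t, Set.union_inter_distrib_right]
    exact measureReal_union ((cyl_disj t).mono Set.inter_subset_left Set.inter_subset_left)
      ((meas_cyl _).inter hK.measurableSet)
  have hκ0 : ∀ t, 0 ≤ κ t := fun t => measureReal_nonneg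
  have hsp : ∀ (t : List Bool) (m : ℚ), ∃ p : ℚ × ℚ, (0 ≤ m ∧ (m = 0 ∨ (m : ℝ) < κ t)) →
      p.1 + p.2 = m ∧ (0 ≤ p.1 ∧ (p.1 = 0 ∨ (p.1 : ℝ) < κ (t ++ [false]))) ∧
      (0 ≤ p.2 ∧ (p.2 = 0 ∨ (p.2 : ℝ) < κ (t ++ [true]))) := by
    intro t m
    by_cases h : 0 ≤ m ∧ (m = 0 ∨ (m : ℝ) < κ t)
    · obtain ⟨p, hp⟩ := split_exists (κ t) _ _ (hκs t) (hκ0 _) (hκ0 _) m h.1 h.2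
      exact ⟨p, fun _ => hp⟩
    · exact ⟨(0, 0), fun h' => absurd h' h⟩
  choose sp hsp using hsp
  obtain ⟨m0, hm0, hm0'⟩ := exists_rat_btwn hμK
  have hcylnil : κ [] = μ.real K := by
    have : cyl [] = Set.univ := Set.eq_univ_of_forall mem_cyl_nil
    simp [κ, this]
  let cur : List GRound → ℚ := fun h => h.foldl (fun _ g => Vb g.1 g.2) m0
  let σ : StratI := fun h => sp (h.map Prod.snd) (cur h)
  refine ⟨σ, fun r hr => ?_⟩
  have hpath : ∀ n, (hist r n).map Prod.snd = path r n := by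
    intro n; simp [hist, path, bits, Function.comp_def]
  have hpaths : ∀ n, path r (n+1) = path r n ++ [bits r n] := by
    intro n; simp [path, List.range_succ]
  have hcurs : ∀ n, cur (hist r (n+1)) = sel r n := by
    intro n
    simp only [cur, hist, List.range_succ, List.map_append, List.foldl_append]
    rfl
  have hrn : ∀ n, (r n).1 = sp (path r n) (cur (hist r n)) := by
    intro n; rw [hr n]; simp only [σ]; rw [hpath]
  have hinv : ∀ n, 0 ≤ cur (hist r n) ∧ (cur (hist r n) = 0 ∨ (cur (hist r n) : ℝ) < κ (path r n)) := by
    intro n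
    induction n with
    | zero =>
      have h1 : cur (hist r 0) = m0 := by simp [cur, hist]
      have h2 : path r 0 = [] := by simp [path]
      rw [h1, h2, hcylnil]
      have : (0:ℝ) ≤ m0 := hs0.trans hm0.le
      exact ⟨by exact_mod_cast this, Or.inr hm0'⟩
    | succ n ih =>
      have h := hsp _ _ ih
      rw [← hrn] at h
      rw [hcurs, hpaths, sel, valI]
      cases bits r n
      · exact h.2.1
      · exact h.2.2
  have hall : ∀ n, (r n).1.1 + (r n).1.2 = cur (hist r n) ∧
      ∀ b, 0 ≤ valI r n b ∧ (valI r n b = 0 ∨ (valI r n b : ℝ) < κ (path r n ++ [b])) := by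
    intro n
    have h := hsp _ _ (hinv n)
    rw [← hrn] at h
    refine ⟨h.1, fun b => ?_⟩
    cases b
    · exact h.2.1
    · exact h.2.2
  have hmOK : ∀ n b, mOK μ r n b := by
    intro n b
    obtain ⟨h1, h2⟩ := (hall n).2 b
    have hle : κ (path r n ++ [b]) ≤ (μ (cyl (path r n ++ [b]))).toReal :=
      measureReal_mono Set.inter_subset_left
    refine ⟨h1, ?_, fun hpos => ?_⟩
    · rcases h2 with h2 | h2
      · rw [h2]; simp
      · linarith
    · rcases h2 with h2 | h2
      · rw [h2]; simpa using hpos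
      · linarith
  have hIOK : ∀ n, IOK μ s r n := by
    intro n
    cases n with
    | zero =>
      refine ⟨hmOK _ _, hmOK _ _, ?_⟩
      have := (hall 0).1
      have h1 : cur (hist r 0) = m0 := by simp [cur, hist]
      rw [h1] at this
      have h2 : ((r 0).1.1 : ℝ) + ((r 0).1.2 : ℝ) = m0 := by exact_mod_cast this
      rw [h2]; exact hm0
    | succ n =>
      refine ⟨hmOK _ _, hmOK _ _, ?_⟩
      rw [← hcurs]; exact (hall (n+1)).1
  rintro (⟨n, -, hn⟩ | ⟨hleg, hA⟩)
  · exact hn (hIOK n)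
  · refine hKA _ ?_ hA
    rw [← hK.closure_eq, mem_closure_iff_nhds]
    intro U hU
    obtain ⟨n, hn⟩ := cyl_nhds _ U hU
    have h1 := (hinv (n+1))
    have h2 := (hleg n).2
    rw [IIOK, ← hcurs] at h2
    have h3 := h1.2.resolve_left h2
    have h4 : (0:ℝ) < κ (path r (n+1)) := lt_of_le_of_lt (by exact_mod_cast h1.1) h3
    have h5 : (cyl (path r (n+1)) ∩ K).Nonempty := by
      by_contra h
      rw [Set.not_nonempty_iff_eq_empty] at h
      simp [κ, h] at h4
    obtain ⟨x, hx, hxK⟩ := h5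
    exact ⟨x, hn (cyl_pre_anti (bits r) (Nat.le_succ n) hx), hxK⟩

/-! ### Player II -/

def stepII (τ : StratIIU) (h : List GRoundU) (g : GRound) : List GRoundU := h ++ [(g.1, τ h g.1)]

def LII (τ : StratIIU) (h : List GRound) : List GRoundU := h.foldl (stepII τ) []

theorem unfold_II (μ : Measure Cantor) (F : Set (Cantor × Baire)) (s : ℝ) (h : WinsIIU μ s F) :
    WinsII μ s {x : Cantor | ∃ y : Baire, (x, y) ∈ F} := by
  obtain ⟨τ, hτ⟩ := h
  refine ⟨fun h p => (τ (LII τ h) p).1, fun r hr => ?_⟩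
  let R : RunU := fun n => ((r n).1, τ (LII τ (hist r n)) (r n).1)
  have hh : ∀ n, histU R n = LII τ (hist r n) := by
    intro n
    induction n with
    | zero => simp [histU, hist, LII]
    | succ n ih =>
      have h1 : histU R (n+1) = histU R n ++ [R n] := by simp [histU, List.range_succ]
      have h2 : hist r (n+1) = hist r n ++ [r n] := by simp [hist, List.range_succ]
      rw [h1, h2, ih, LII, LII, List.foldl_append]
      rfl
  have hc : ConsIIU τ R := by
    intro n; rw [hh]
  have hbit : bitsU R = bits r := by
    funext n; exact (hr n).symm
  have hval : ∀ n b, valIU R n b = valI r n b := fun n b => rfl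
  have hsel : ∀ n, selU R n = sel r n := by
    intro n; rw [selU, sel, hbit]; rfl
  have hpath : ∀ n, pathU R n = path r n := by
    intro n; rw [pathU, path, hbit]
  have hm : ∀ n b, mOKU μ R n b ↔ mOK μ r n b := by
    intro n b; rw [mOKU, mOK, hpath, hval]
  have hI : ∀ n, IOKU μ s R n ↔ IOK μ s r n := by
    intro n
    cases n with
    | zero => rw [IOKU, IOK, hm, hm]
    | succ n => rw [IOKU, IOK, hm, hm, hsel]
  have hII : ∀ n, IIOKU R n ↔ IIOK r n := by
    intro n; rw [IIOKU, IIOK, hsel]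
  have := hτ R hc
  unfold IIWinsRunU at this
  unfold IIWinsRun
  simp only [hI, hII, hbit] at this
  rcases this with h | ⟨h1, y, -, h2⟩
  · exact Or.inl h
  · exact Or.inr ⟨h1, y, h2⟩

/-- Unfolding: if a player wins the unfolded game `G_unfolded(s, F)`, then the same player
wins the measure game `G(s, A)` where `A = {x : ∃ y, (x, y) ∈ F}`. -/
theorem unfolding (μ : Measure Cantor) [IsProbabilityMeasure μ]
    (F : Set (Cantor × Baire)) (s : ℝ) (hs0 : 0 ≤ s) (hs1 : s < 1) :
    (WinsIU μ s F → WinsI μ s {x : Cantor | ∃ y : Baire, (x, y) ∈ F}) ∧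
    (WinsIIU μ s F → WinsII μ s {x : Cantor | ∃ y : Baire, (x, y) ∈ F}) := by
  refine ⟨?_, unfold_II μ F s⟩
  rintro ⟨σ, hσ⟩
  obtain ⟨K, hK, h1, h2⟩ := unfold_I σ μ F s hs0 hσ
  exact wins_of_closed μ _ s hs0 K hK h1 (fun x hx ⟨y, hy⟩ => h2 x hx y hy)

end MeasureGame
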